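/- The orbit of the vector v₁ := (1, 0, 0, 0, 0, 0) ∈ ℚ⁶ under the subgroup of GL(6,ℚ) generated by the four matrices g_B, g_d, g_e, g_f (a group isomorphic to the Weyl group W(E₆)) consists of exactly 27 vectors. -/

import Mathlib

open Matrix

/-- The canonical ring homomorphism from integer 6×6 matrices to rational 6×6 matrices. -/
def φ : Matrix (Fin 6) (Fin 6) ℤ →+* Matrix (Fin 6) (Fin 6) ℚ :=
  (Int.castRingHom ℚ).mapMatrix

/-- `g_B` swaps the last two coordinates `X₆, X₇` and fixes the other coordinates. -/
def gB : Matrix (Fin 6) (Fin 6) ℚ :=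
  φ !![1,0,0,0,0,0; 0,1,0,0,0,0; 0,0,1,0,0,0; 0,0,0,1,0,0; 0,0,0,0,0,1; 0,0,0,0,1,0]

/-- `g_d = diag(1, 1, −1, −1, −1, −1)`. -/
def gd : Matrix (Fin 6) (Fin 6) ℚ :=
  φ !![1,0,0,0,0,0; 0,1,0,0,0,0; 0,0,-1,0,0,0; 0,0,0,-1,0,0; 0,0,0,0,-1,0; 0,0,0,0,0,-1]

/-- `g_e = diag(1, 1, 1, −1, −1, 1)`. -/
def ge : Matrix (Fin 6) (Fin 6) ℚ :=
  φ !![1,0,0,0,0,0; 0,1,0,0,0,0; 0,0,1,0,0,0; 0,0,0,-1,0,0; 0,0,0,0,-1,0; 0,0,0,0,0,1]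

/-- `g_f`, acting on column vectors. -/
def gf : Matrix (Fin 6) (Fin 6) ℚ :=
  (1/4 : ℚ) • φ !![1,3,3,3,3,3; 1,-1,3,-1,-1,-1; 1,3,-1,-1,-1,-1;
                   1,-1,-1,3,-1,-1; 1,-1,-1,-1,-1,3; 1,-1,-1,-1,3,-1]

lemma gB_sq : gB * gB = 1 := by
  rw [gB, ← _root_.map_mul, show (!![1,0,0,0,0,0; 0,1,0,0,0,0; 0,0,1,0,0,0; 0,0,0,1,0,0;
    0,0,0,0,0,1; 0,0,0,0,1,0] : Matrix (Fin 6) (Fin 6) ℤ) * _ = 1 by decide, _root_.map_one]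

lemma gd_sq : gd * gd = 1 := by
  rw [gd, ← _root_.map_mul, show (!![1,0,0,0,0,0; 0,1,0,0,0,0; 0,0,-1,0,0,0; 0,0,0,-1,0,0;
    0,0,0,0,-1,0; 0,0,0,0,0,-1] : Matrix (Fin 6) (Fin 6) ℤ) * _ = 1 by decide, _root_.map_one]

lemma ge_sq : ge * ge = 1 := by
  rw [ge, ← _root_.map_mul, show (!![1,0,0,0,0,0; 0,1,0,0,0,0; 0,0,1,0,0,0; 0,0,0,-1,0,0;
    0,0,0,0,-1,0; 0,0,0,0,0,1] : Matrix (Fin 6) (Fin 6) ℤ) * _ = 1 by decide, _root_.map_one]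

lemma gf_sq : gf * gf = 1 := by
  rw [gf, smul_mul_smul_comm, ← _root_.map_mul,
    show (!![1,3,3,3,3,3; 1,-1,3,-1,-1,-1; 1,3,-1,-1,-1,-1; 1,-1,-1,3,-1,-1;
      1,-1,-1,-1,-1,3; 1,-1,-1,-1,3,-1] : Matrix (Fin 6) (Fin 6) ℤ) * _ = 16 by decide,
    map_ofNat φ 16,
    ← map_ofNat (algebraMap ℚ (Matrix (Fin 6) (Fin 6) ℚ)) 16,
    Algebra.algebraMap_eq_smul_one, smul_smul]
  norm_num

/-- `g_B` as an element of `GL(6,ℚ)` (it is an involution). -/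
def gBu : GL (Fin 6) ℚ := ⟨gB, gB, gB_sq, gB_sq⟩

/-- `g_d` as an element of `GL(6,ℚ)` (it is an involution). -/
def gdu : GL (Fin 6) ℚ := ⟨gd, gd, gd_sq, gd_sq⟩

/-- `g_e` as an element of `GL(6,ℚ)` (it is an involution). -/
def geu : GL (Fin 6) ℚ := ⟨ge, ge, ge_sq, ge_sq⟩

/-- `g_f` as an element of `GL(6,ℚ)` (it is an involution). -/
def gfu : GL (Fin 6) ℚ := ⟨gf, gf, gf_sq, gf_sq⟩

/-- Four times the vectors of the orbit, as the rows of an integer matrix. -/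
def orbitTable : Matrix (Fin 27) (Fin 6) ℤ :=
  !![4, 0, 0, 0, 0, 0;
    1, 1, 1, 1, 1, 1;
    1, 1, -1, -1, -1, -1;
    1, 1, 1, -1, -1, 1;
    1, 1, -1, 1, 1, -1;
    -2, 0, 2, 0, 0, 0;
    1, 1, 1, -1, 1, -1;
    1, 1, -1, 1, -1, 1;
    1, -1, 1, 1, -1, 1;
    -2, 0, -2, 0, 0, 0;
    1, 1, 1, 1, -1, -1;
    1, 1, -1, -1, 1, 1;
    1, -1, 1, 1, 1, -1;
    1, -1, -1, -1, 1, -1;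
    1, -1, 1, -1, 1, 1;
    -2, -2, 0, 0, 0, 0;
    1, -1, -1, -1, -1, 1;
    1, -1, 1, -1, -1, -1;
    1, -1, -1, 1, -1, -1;
    -2, 0, 0, 0, 0, 2;
    1, -1, -1, 1, 1, 1;
    -2, 0, 0, 0, 2, 0;
    -2, 2, 0, 0, 0, 0;
    -2, 0, 0, 2, 0, 0;
    -2, 0, 0, 0, 0, -2;
    -2, 0, 0, 0, -2, 0;
    -2, 0, 0, -2, 0, 0]

/-- The vectors of the orbit. -/
def orbitVec (i : Fin 27) : Fin 6 → ℚ := fun j => (orbitTable i j : ℚ) / 4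

/-- The permutation of the orbit induced by `gB`. -/
def permB : Equiv.Perm (Fin 27) := Function.Involutive.toPerm
  ![0, 1, 2, 6, 7, 5, 3, 4, 12, 9, 10, 11, 8, 16,
    14, 15, 13, 17, 18, 21, 20, 19, 22, 23, 25, 24, 26]
  (by unfold Function.Involutive; decide)

/-- The permutation of the orbit induced by `gd`. -/
def permd : Equiv.Perm (Fin 27) := Function.Involutive.toPerm
  ![0, 2, 1, 4, 3, 9, 7, 6, 13, 5, 11, 10, 16, 8,
    18, 15, 12, 20, 14, 24, 17, 25, 22, 26, 19, 21, 23]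
  (by unfold Function.Involutive; decide)

/-- The permutation of the orbit induced by `ge`. -/
def perme : Equiv.Perm (Fin 27) := Function.Involutive.toPerm
  ![0, 3, 4, 1, 2, 5, 10, 11, 14, 9, 6, 7, 17, 18,
    8, 15, 20, 12, 13, 19, 16, 25, 22, 26, 24, 21, 23]
  (by unfold Function.Involutive; decide)

/-- The permutation of the orbit induced by `gf`. -/
def permf : Equiv.Perm (Fin 27) := Function.Involutive.toPerm
  ![1, 0, 5, 6, 8, 2, 3, 12, 4, 15, 10, 14, 7, 19,
    11, 9, 21, 22, 23, 13, 20, 16, 17, 18, 25, 24, 26]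
  (by unfold Function.Involutive; decide)

lemma orbitVec_zero : orbitVec 0 = ![1, 0, 0, 0, 0, 0] := by
  ext j
  fin_cases j <;> simp [orbitVec, orbitTable]

lemma orbitVec_injective : Function.Injective orbitVec := by
  have hT : ∀ i k, i ≠ k → ∃ j, orbitTable i j - orbitTable k j ≠ 0 := by decide
  intro i k h
  by_contra hik
  obtain ⟨j, hne⟩ := hT i k hik
  refine hne (sub_eq_zero.mpr ?_)
  have hj := congrFun h j
  simp only [orbitVec] at hj
  exact_mod_cast (div_left_inj' (by norm_num : (4 : ℚ) ≠ 0)).mp hj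

/-- The action of an integer matrix on the orbit can be computed on the integer table. -/
lemma φ_mulVec_orbitVec (A : Matrix (Fin 6) (Fin 6) ℤ) (c : ℤ) {i k : Fin 27}
    (h : ∀ j, (A *ᵥ orbitTable i) j = c * orbitTable k j) :
    φ A *ᵥ orbitVec i = (c : ℚ) • orbitVec k := by
  ext j
  have hj := congrArg (fun z : ℤ => (z : ℚ) / 4) (h j)
  simp only [mulVec, dotProduct, Int.cast_sum, Int.cast_mul, Finset.sum_div] at hj
  simpa [φ, orbitVec, mulVec, dotProduct, mul_div_assoc] using hj

lemma gB_mulVec_orbitVec (i : Fin 27) : gB *ᵥ orbitVec i = orbitVec (permB i) := by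
  rw [gB, φ_mulVec_orbitVec _ 1 (k := permB i), Int.cast_one, one_smul]
  revert i
  decide

lemma gd_mulVec_orbitVec (i : Fin 27) : gd *ᵥ orbitVec i = orbitVec (permd i) := by
  rw [gd, φ_mulVec_orbitVec _ 1 (k := permd i), Int.cast_one, one_smul]
  revert i
  decide

lemma ge_mulVec_orbitVec (i : Fin 27) : ge *ᵥ orbitVec i = orbitVec (perme i) := by
  rw [ge, φ_mulVec_orbitVec _ 1 (k := perme i), Int.cast_one, one_smul]
  revert i
  decide

lemma gf_mulVec_orbitVec (i : Fin 27) : gf *ᵥ orbitVec i = orbitVec (permf i) := by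
  rw [gf, smul_mulVec, φ_mulVec_orbitVec _ 4 (k := permf i), smul_smul]
  · norm_num
  · revert i
    decide

lemma exists_perm_of_mem_closure {g : GL (Fin 6) ℚ}
    (hg : g ∈ Subgroup.closure ({gBu, gdu, geu, gfu} : Set (GL (Fin 6) ℚ))) :
    ∃ σ : Equiv.Perm (Fin 27), ∀ i, g.val *ᵥ orbitVec i = orbitVec (σ i) := by
  induction hg using Subgroup.closure_induction with
  | mem x hx =>
    rcases hx with rfl | rfl | rfl | rfl
    · exact ⟨permB, gB_mulVec_orbitVec⟩
    · exact ⟨permd, gd_mulVec_orbitVec⟩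
    · exact ⟨perme, ge_mulVec_orbitVec⟩
    · exact ⟨permf, gf_mulVec_orbitVec⟩
  | one => exact ⟨1, fun i => by simp⟩
  | mul x y _ _ hx hy =>
    obtain ⟨σ, hσ⟩ := hx
    obtain ⟨τ, hτ⟩ := hy
    exact ⟨σ * τ, fun i => by rw [Units.val_mul, ← mulVec_mulVec, hτ, hσ, Equiv.Perm.mul_apply]⟩
  | inv x _ hx =>
    obtain ⟨σ, hσ⟩ := hx
    refine ⟨σ⁻¹, fun i => ?_⟩
    have h := hσ (σ⁻¹ i)
    rw [← Equiv.Perm.mul_apply, mul_inv_cancel, Equiv.Perm.one_apply] at h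
    rw [← h, mulVec_mulVec, ← Units.val_mul, inv_mul_cancel, Units.val_one, one_mulVec]

/-- Every index other than `0` is the image of a smaller one under a generator. -/
lemma exists_lt_perm_eq (i : Fin 27) (hi : i ≠ 0) :
    ∃ j < i, permB j = i ∨ permd j = i ∨ perme j = i ∨ permf j = i := by
  revert i
  decide

lemma exists_mem_closure_mulVec_eq (i : Fin 27) :
    ∃ g ∈ Subgroup.closure ({gBu, gdu, geu, gfu} : Set (GL (Fin 6) ℚ)),
      g.val *ᵥ orbitVec 0 = orbitVec i := by
  induction i using WellFoundedLT.induction with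
  | ind i ih =>
    by_cases hi : i = 0
    · exact ⟨1, one_mem _, by simp [hi]⟩
    obtain ⟨j, hj, h⟩ := exists_lt_perm_eq i hi
    obtain ⟨g, hg, hgj⟩ := ih j hj
    have step (s : GL (Fin 6) ℚ) (hs : s ∈ ({gBu, gdu, geu, gfu} : Set (GL (Fin 6) ℚ)))
        (hsj : s.val *ᵥ orbitVec j = orbitVec i) :
        ∃ g ∈ Subgroup.closure ({gBu, gdu, geu, gfu} : Set (GL (Fin 6) ℚ)),
          g.val *ᵥ orbitVec 0 = orbitVec i :=
      ⟨s * g, mul_mem (Subgroup.subset_closure hs) hg, by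
        rw [Units.val_mul, ← mulVec_mulVec, hgj, hsj]⟩
    rcases h with h | h | h | h
    · exact step gBu (by simp) (h ▸ gB_mulVec_orbitVec j)
    · exact step gdu (by simp) (h ▸ gd_mulVec_orbitVec j)
    · exact step geu (by simp) (h ▸ ge_mulVec_orbitVec j)
    · exact step gfu (by simp) (h ▸ gf_mulVec_orbitVec j)

/-- The orbit of `v₁ = (1,0,0,0,0,0) ∈ ℚ⁶` under the subgroup of `GL(6,ℚ)` generated
by `g_B, g_d, g_e, g_f` (a group isomorphic to the Weyl group `W(E₆)`) consists of
exactly 27 vectors. -/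
theorem stmt_19 :
    Set.ncard {w : Fin 6 → ℚ |
      ∃ g ∈ Subgroup.closure ({gBu, gdu, geu, gfu} : Set (GL (Fin 6) ℚ)),
        (g : Matrix (Fin 6) (Fin 6) ℚ).mulVec ![1, 0, 0, 0, 0, 0] = w} = 27 := by
  rw [← orbitVec_zero]
  trans (Set.range orbitVec).ncard
  swap
  · rw [Set.ncard_range_of_injective orbitVec_injective, Nat.card_fin]
  congr 1
  ext w
  constructor
  · rintro ⟨g, hg, rfl⟩
    obtain ⟨σ, hσ⟩ := exists_perm_of_mem_closure hg
    exact ⟨σ 0, (hσ 0).symm⟩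
  · rintro ⟨i, rfl⟩
    exact exists_mem_closure_mulVec_eq i
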